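/- Let V be a real symmetric positive-definite 2N×2N matrix (an invertible covariance matrix), J the 2N×2N symplectic form, and D(V) = γ_L·(J B V + V B J − J A J) + γ_U·Σ_j κ_j (K_j V K_jᵀ − V) the symplectic-picture dissipator, where γ_L, γ_U ≥ 0, A = Re(C†C) and B = Im(C†C) for a complex matrix C with 2N columns, the κ_j ≥ 0 satisfy Σ_j κ_j = 1, and each K_j is a real symplectic matrix (K_j J K_jᵀ = J). Then there exists a real symmetric 2N×2N matrix G with JGV − VGJ + D(V) = 0 if and only if for every z ∈ ℂ and all vectors v, w ∈ ℂ^{2N} with (JV)v = zv and (JV)w = zw one has v† D(V) w = 0 (where JV and D(V) are regarded as complex matrices). -/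

import Mathlib

open Matrix

section Diagonalization

open scoped ComplexOrder MatrixOrder

variable {n : Type*} [Fintype n] [DecidableEq n]

/-- A positive-definite real matrix stays positive definite over `ℂ`. -/
theorem Matrix.PosDef.map_complex_ofReal {V : Matrix n n ℝ} (hV : V.PosDef) :
    (V.map Complex.ofReal).PosDef := by
  obtain ⟨R, hR⟩ := CStarAlgebra.nonneg_iff_eq_star_mul_self.mp hV.posSemidef.nonneg
  have hmap : V.map Complex.ofReal = (R.map Complex.ofReal)ᴴ * R.map Complex.ofReal := by
    ext i j
    simp [hR, star_eq_conjTranspose, mul_apply]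
  have hpsd : (V.map Complex.ofReal).PosSemidef := by
    rw [hmap]
    exact posSemidef_conjTranspose_mul_self _
  exact hpsd.posDef_iff_isUnit.mpr (hV.isUnit.map (Complex.ofRealHom.mapMatrix (m := n)))

/-- A positive-definite and a Hermitian matrix are simultaneously diagonalizable by congruence. -/
theorem Matrix.PosDef.exists_congruence_diagonal {V H : Matrix n n ℂ} (hV : V.PosDef)
    (hH : H.IsHermitian) :
    ∃ (Q : Matrix n n ℂ) (l : n → ℂ), Qᴴ * V * Q = 1 ∧ Qᴴ * H * Q = diagonal l := by
  obtain ⟨R, hR⟩ := CStarAlgebra.nonneg_iff_eq_star_mul_self.mp hV.posSemidef.nonneg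
  rw [star_eq_conjTranspose] at hR
  have hRu : IsUnit R.det := by
    have hdet := (isUnit_iff_isUnit_det V).mp hV.isUnit
    rw [hR, det_mul] at hdet
    exact isUnit_of_mul_isUnit_right hdet
  have hRR : R * R⁻¹ = 1 := mul_nonsing_inv R hRu
  have hRR' : (R⁻¹)ᴴ * Rᴴ = 1 := by rw [← conjTranspose_mul, hRR, conjTranspose_one]
  have hS : ((R⁻¹)ᴴ * H * R⁻¹).IsHermitian := isHermitian_conjTranspose_mul_mul _ hH
  have hU : (hS.eigenvectorUnitary : Matrix n n ℂ)ᴴ * hS.eigenvectorUnitary = 1 :=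
    Unitary.coe_star_mul_self _
  refine ⟨R⁻¹ * hS.eigenvectorUnitary, RCLike.ofReal ∘ hS.eigenvalues, ?_, ?_⟩
  · calc _ = (hS.eigenvectorUnitary : Matrix n n ℂ)ᴴ * (((R⁻¹)ᴴ * Rᴴ) * (R * R⁻¹))
          * hS.eigenvectorUnitary := by
          rw [hR]
          simp only [conjTranspose_mul, Matrix.mul_assoc]
      _ = 1 := by rw [hRR, hRR', Matrix.mul_one, Matrix.mul_one, hU]
  · rw [← hS.conjStarAlgAut_star_eigenvectorUnitary, Unitary.conjStarAlgAut_star_apply]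
    simp only [conjTranspose_mul, Matrix.mul_assoc, star_eq_conjTranspose]

/-- Solvability of `J G V - V G J + D = 0` over `ℂ` when `D` vanishes on the eigenspaces
of `J V`. -/
theorem exists_complex_hamiltonian {V J D : Matrix n n ℂ} (hV : V.PosDef) (hJ : Jᴴ = -J)
    (hJJ : J * J = -1)
    (hD : ∀ (z : ℂ) (v w : n → ℂ), (J * V) *ᵥ v = z • v → (J * V) *ᵥ w = z • w →
      star v ⬝ᵥ (D *ᵥ w) = 0) :
    ∃ G : Matrix n n ℂ, J * G * V - V * G * J + D = 0 := by
  have hH : (Complex.I • J).IsHermitian := by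
    simp [IsHermitian, conjTranspose_smul, hJ]
  obtain ⟨Q, l, hQV, hQl⟩ := hV.exists_congruence_diagonal hH
  obtain ⟨f, hQJ⟩ : ∃ f : n → ℂ, Qᴴ * J * Q = diagonal f := by
    refine ⟨fun i => -Complex.I * l i, ?_⟩
    calc Qᴴ * J * Q = (-Complex.I) • (Qᴴ * (Complex.I • J) * Q) := by
          simp [smul_smul]
      _ = _ := by
          rw [hQl, ← diagonal_smul]
          rfl
  have hVQ : Qᴴ * (V * Q) = 1 := by rw [← Matrix.mul_assoc, hQV]
  have hVQ' : V * Q * Qᴴ = 1 := mul_eq_one_comm.mp hVQ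
  have hQV' : Q * (Qᴴ * V) = 1 := mul_eq_one_comm.mp hQV
  have hJQ : J * Q = V * Q * diagonal f := by
    rw [← hQJ, Matrix.mul_assoc Qᴴ, ← Matrix.mul_assoc (V * Q), hVQ', Matrix.one_mul]
  have hinv : J * V * Q * diagonal f = -Q := by
    rw [Matrix.mul_assoc J, Matrix.mul_assoc J, ← hJQ, ← Matrix.mul_assoc, hJJ]
    simp
  have hcol (i : n) : f i • ((J * V) *ᵥ Q.col i) = -Q.col i := by
    funext a
    have h := congrFun (congrFun hinv a) i
    rw [mul_diagonal, mul_apply] at h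
    simpa [mulVec, dotProduct, mul_comm] using h
  have hf (i : n) : f i ≠ 0 := by
    intro h0
    have h1 := hcol i
    rw [h0, zero_smul, eq_comm, neg_eq_zero] at h1
    have h2 := congrFun (congrFun hQV i) i
    rw [mul_apply] at h2
    have h3 (a : n) : Q a i = 0 := congrFun h1 a
    simp [h3] at h2
  have heig (i : n) : (J * V) *ᵥ Q.col i = (-(f i)⁻¹) • Q.col i := by
    rw [neg_smul, ← smul_neg, ← hcol i, smul_smul, inv_mul_cancel₀ (hf i), one_smul]
  have hE (i j : n) (hij : f i = f j) : (Qᴴ * D * Q) i j = 0 := by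
    have h := hD (-(f i)⁻¹) (Q.col i) (Q.col j) (heig i) (by rw [hij, heig j])
    rw [← h, Matrix.mul_assoc, mul_apply]
    simp [dotProduct, mulVec, mul_apply]
  let h : Matrix n n ℂ := of fun i j => -(Qᴴ * D * Q) i j / (f i - f j)
  have hcore : diagonal f * h - h * diagonal f + Qᴴ * D * Q = 0 := by
    ext i j
    simp only [Matrix.add_apply, Matrix.sub_apply, diagonal_mul, mul_diagonal, h, of_apply,
      Matrix.zero_apply]
    by_cases hij : f i = f j
    · rw [hE i j hij]; simp
    · have := sub_ne_zero.mpr hij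
      field_simp
      ring
  have hconj : Qᴴ * (J * (Q * h * Qᴴ) * V - V * (Q * h * Qᴴ) * J + D) * Q = 0 := by
    rw [← hcore, ← hQJ, Matrix.mul_add, Matrix.add_mul, Matrix.mul_sub, Matrix.sub_mul]
    congr 2
    · calc _ = (Qᴴ * J * Q) * h * (Qᴴ * V * Q) := by simp only [Matrix.mul_assoc]
        _ = _ := by rw [hQV, Matrix.mul_one]
    · calc _ = (Qᴴ * V * Q) * (h * (Qᴴ * J * Q)) := by simp only [Matrix.mul_assoc]
        _ = _ := by rw [hQV, Matrix.one_mul]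
  refine ⟨Q * h * Qᴴ, ?_⟩
  generalize J * (Q * h * Qᴴ) * V - V * (Q * h * Qᴴ) * J + D = X at hconj ⊢
  calc X = (V * Q * Qᴴ) * X * (Q * (Qᴴ * V)) := by
        rw [hVQ', hQV', Matrix.one_mul, Matrix.mul_one]
    _ = V * Q * (Qᴴ * X * Q) * (Qᴴ * V) := by simp only [Matrix.mul_assoc]
    _ = 0 := by rw [hconj]; simp

/-- If `J G V - V G J + D = 0`, then `D` vanishes on the eigenspaces of `J V`. -/
theorem dissipator_vanishes_on_eigenspace {V J D G : Matrix n n ℂ} (hV : V.PosDef)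
    (hJ : Jᴴ = -J) (hJJ : J * J = -1) (hG : J * G * V - V * G * J + D = 0)
    {z : ℂ} {v w : n → ℂ} (hv : (J * V) *ᵥ v = z • v) (hw : (J * V) *ᵥ w = z • w) :
    star v ⬝ᵥ (D *ᵥ w) = 0 := by
  have key {u : n → ℂ} (hu : (J * V) *ᵥ u = z • u) : V *ᵥ u = -z • (J *ᵥ u) := by
    have h : J *ᵥ ((J * V) *ᵥ u) = z • (J *ᵥ u) := by rw [hu, mulVec_smul]
    rw [mulVec_mulVec, ← Matrix.mul_assoc, hJJ, Matrix.neg_mul, Matrix.one_mul,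
      neg_mulVec] at h
    rw [neg_smul, ← h, neg_neg]
  have keystar : star v ᵥ* V = star z • (star v ᵥ* J) := by
    have h := congrArg star (key hv)
    rw [star_smul, star_mulVec, star_mulVec, hV.isHermitian.eq, hJ, vecMul_neg] at h
    simpa using h
  have hDeq : D = V * G * J - J * G * V := by
    rw [← sub_eq_zero, ← hG]
    abel
  have hsum (u : n → ℂ) (hu : V *ᵥ u = -z • (J *ᵥ u)) :
      star v ⬝ᵥ (D *ᵥ u) = (star z + z) * (star v ᵥ* J ⬝ᵥ (G *ᵥ (J *ᵥ u))) := by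
    rw [hDeq, sub_mulVec, dotProduct_sub, Matrix.mul_assoc, Matrix.mul_assoc,
      ← mulVec_mulVec, ← mulVec_mulVec, ← mulVec_mulVec, ← mulVec_mulVec, hu,
      dotProduct_mulVec _ V, keystar, mulVec_smul, mulVec_smul, dotProduct_smul,
      dotProduct_mulVec _ J, smul_dotProduct, smul_eq_mul, smul_eq_mul]
    ring
  rw [hsum w (key hw)]
  by_cases hv0 : v = 0
  · simp [hv0]
  have hpos := (hV.dotProduct_mulVec_pos hv0).ne'
  have e1 : star v ⬝ᵥ (V *ᵥ v) = star z * (star v ⬝ᵥ (J *ᵥ v)) := by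
    rw [dotProduct_mulVec, keystar, smul_dotProduct, smul_eq_mul, ← dotProduct_mulVec]
  have e2 : star v ⬝ᵥ (V *ᵥ v) = -z * (star v ⬝ᵥ (J *ᵥ v)) := by
    rw [key hv, dotProduct_smul, smul_eq_mul]
  have hJv : star v ⬝ᵥ (J *ᵥ v) ≠ 0 := by
    intro h
    rw [h, mul_zero] at e1
    exact hpos e1
  have hz : star z + z = 0 := by
    have : (star z + z) * (star v ⬝ᵥ (J *ᵥ v)) = 0 := by linear_combination e2 - e1
    exact (mul_eq_zero.mp this).resolve_right hJv
  rw [hz, zero_mul]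

/-- The entrywise real part commutes with multiplication by real matrices on both sides. -/
theorem map_re_mul_mul {m : Type*} [Fintype m] {P R : Matrix m m ℝ} (G : Matrix m m ℂ) :
    (P.map Complex.ofReal * G * R.map Complex.ofReal).map Complex.re =
      P * G.map Complex.re * R := by
  ext i j
  simp [mul_apply, Complex.re_sum]

/-- Stabilizability criterion for a symmetric dissipator value `D`. -/
theorem exists_symm_hamiltonian_iff {V J D : Matrix n n ℝ} (hV : V.PosDef) (hVt : Vᵀ = V)
    (hJ : Jᵀ = -J) (hJJ : J * J = -1) (hD : Dᵀ = D) :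
    (∃ G : Matrix n n ℝ, Gᵀ = G ∧ J * G * V - V * G * J + D = 0) ↔
    (∀ (z : ℂ) (v w : n → ℂ),
        (J * V).map Complex.ofReal *ᵥ v = z • v →
        (J * V).map Complex.ofReal *ᵥ w = z • w →
        star v ⬝ᵥ (D.map Complex.ofReal *ᵥ w) = 0) := by
  have hmul (P R : Matrix n n ℝ) :
      (P * R).map Complex.ofReal = P.map Complex.ofReal * R.map Complex.ofReal :=
    map_mul (Complex.ofRealHom.mapMatrix (m := n)) P R
  have hVc := hV.map_complex_ofReal
  have hJc : (J.map Complex.ofReal)ᴴ = -J.map Complex.ofReal := by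
    ext i j
    have := congrFun (congrFun hJ i) j
    simp only [transpose_apply, Matrix.neg_apply] at this
    simp [this]
  have hJJc : J.map Complex.ofReal * J.map Complex.ofReal = -1 := by
    rw [← hmul, hJJ]
    exact map_neg (Complex.ofRealHom.mapMatrix (m := n)) 1 |>.trans (by rw [map_one])
  simp only [hmul]
  constructor
  · rintro ⟨G, -, hG⟩ z v w hv hw
    refine dissipator_vanishes_on_eigenspace (G := G.map Complex.ofReal) hVc hJc hJJc ?_ hv hw
    have h := congrArg (Complex.ofRealHom.mapMatrix (m := n)) hG
    simp only [map_add, map_sub, map_mul, map_zero] at h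
    exact h
  · intro h
    obtain ⟨G, hG⟩ := exists_complex_hamiltonian hVc hJc hJJc h
    have hre : J * G.map Complex.re * V - V * G.map Complex.re * J + D = 0 := by
      rw [← map_re_mul_mul, ← map_re_mul_mul]
      ext i j
      have := congrArg Complex.re (congrFun (congrFun hG i) j)
      simpa using this
    generalize G.map Complex.re = X at hre
    have hret : J * Xᵀ * V - V * Xᵀ * J + D = 0 := by
      have := congrArg transpose hre
      simp only [transpose_add, transpose_sub, transpose_mul, hVt, hJ, hD, transpose_zero,
        Matrix.mul_neg, Matrix.neg_mul, ← Matrix.mul_assoc] at this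
      rw [← this]
      abel
    refine ⟨(2⁻¹ : ℝ) • (X + Xᵀ), ?_, ?_⟩
    · rw [transpose_smul, transpose_add, transpose_transpose, add_comm]
    · have : J * ((2⁻¹ : ℝ) • (X + Xᵀ)) * V - V * ((2⁻¹ : ℝ) • (X + Xᵀ)) * J + D =
          (2⁻¹ : ℝ) • ((J * X * V - V * X * J + D) + (J * Xᵀ * V - V * Xᵀ * J + D)) := by
        simp only [Matrix.mul_smul, Matrix.smul_mul, Matrix.mul_add, Matrix.add_mul]
        module
      rw [this, hre, hret]
      simp

end Diagonalization

theorem symplecticForm_transpose {n : ℕ} {J : Matrix (Fin n) (Fin n) ℝ}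
    (hJ : ∀ i j : Fin n, J i j =
      if (j : ℕ) = (i : ℕ) + 1 ∧ (i : ℕ) % 2 = 0 then 1
      else if (i : ℕ) = (j : ℕ) + 1 ∧ (j : ℕ) % 2 = 0 then -1 else 0) : Jᵀ = -J := by
  ext i j
  rw [transpose_apply, Matrix.neg_apply, hJ, hJ]
  split_ifs <;> first | omega | simp

theorem symplecticForm_mul_self {N : ℕ} {J : Matrix (Fin (2*N)) (Fin (2*N)) ℝ}
    (hJ : ∀ i j : Fin (2*N), J i j =
      if (j : ℕ) = (i : ℕ) + 1 ∧ (i : ℕ) % 2 = 0 then 1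
      else if (i : ℕ) = (j : ℕ) + 1 ∧ (j : ℕ) % 2 = 0 then -1 else 0) : J * J = -1 := by
  ext i j
  have hi := i.isLt
  rw [mul_apply, Matrix.neg_apply, one_apply]
  obtain ⟨p, hp⟩ : ∃ p : Fin (2*N),
      ((p : ℕ) = i + 1 ∧ (i : ℕ) % 2 = 0) ∨ ((i : ℕ) = p + 1 ∧ (p : ℕ) % 2 = 0) := by
    rcases Nat.mod_two_eq_zero_or_one i with h | h
    · exact ⟨⟨i + 1, by omega⟩, Or.inl ⟨rfl, h⟩⟩
    · exact ⟨⟨i - 1, by omega⟩, Or.inr ⟨by simp only; omega, by simp only; omega⟩⟩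
  rw [Finset.sum_eq_single p]
  · simp only [hJ, Fin.ext_iff]
    split_ifs <;> first | omega | simp
  · intro b _ hb
    have hb' : (b : ℕ) ≠ p := fun h => hb (Fin.ext h)
    have : J i b = 0 := by
      rw [hJ]
      split_ifs <;> first | omega | rfl
    rw [this, zero_mul]
  · simp

theorem stmt_13 {N m mc : ℕ}
    (V : Matrix (Fin (2*N)) (Fin (2*N)) ℝ) (hVpos : V.PosDef) (hVsymm : Vᵀ = V)
    (J : Matrix (Fin (2*N)) (Fin (2*N)) ℝ)
    (hJ : ∀ i j : Fin (2*N), J i j =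
      if (j : ℕ) = (i : ℕ) + 1 ∧ (i : ℕ) % 2 = 0 then 1
      else if (i : ℕ) = (j : ℕ) + 1 ∧ (j : ℕ) % 2 = 0 then -1 else 0)
    (γL γU : ℝ) (hγL : 0 ≤ γL) (hγU : 0 ≤ γU)
    (C : Matrix (Fin mc) (Fin (2*N)) ℂ)
    (A B : Matrix (Fin (2*N)) (Fin (2*N)) ℝ)
    (hA : A = (Cᴴ * C).map Complex.re) (hB : B = (Cᴴ * C).map Complex.im)
    (κ : Fin m → ℝ) (hκ : ∀ j, 0 ≤ κ j) (hκsum : ∑ j, κ j = 1)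
    (K : Fin m → Matrix (Fin (2*N)) (Fin (2*N)) ℝ)
    (hK : ∀ j, K j * J * (K j)ᵀ = J)
    (DV : Matrix (Fin (2*N)) (Fin (2*N)) ℝ)
    (hDV : DV = γL • (J * B * V + V * B * J - J * A * J)
      + γU • ∑ j, κ j • (K j * V * (K j)ᵀ - V)) :
    (∃ G : Matrix (Fin (2*N)) (Fin (2*N)) ℝ, Gᵀ = G ∧
        J * G * V - V * G * J + DV = 0) ↔
    (∀ (z : ℂ) (v w : Fin (2*N) → ℂ),
        (J * V).map (Complex.ofReal) *ᵥ v = z • v →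
        (J * V).map (Complex.ofReal) *ᵥ w = z • w →
        star v ⬝ᵥ (DV.map (Complex.ofReal) *ᵥ w) = 0) := by
  have hJt := symplecticForm_transpose hJ
  have hAt : Aᵀ = A := by
    ext i j
    simp [hA, mul_apply, Complex.re_sum, mul_comm]
  have hBt : Bᵀ = -B := by
    ext i j
    simp only [hB, transpose_apply, Matrix.neg_apply, map_apply, mul_apply, Complex.im_sum,
      ← Finset.sum_neg_distrib]
    refine Finset.sum_congr rfl fun k _ => ?_
    simp
    ring
  refine exists_symm_hamiltonian_iff hVpos hVsymm hJt (symplecticForm_mul_self hJ) ?_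
  rw [hDV]
  simp only [transpose_add, transpose_sub, transpose_smul, transpose_sum, transpose_mul,
    transpose_transpose, hVsymm, hJt, hAt, hBt, Matrix.mul_neg, Matrix.neg_mul, neg_neg,
    ← Matrix.mul_assoc]
  rw [add_comm (V * B * J)]
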